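/- arXiv:2005.08865 — 2 statements merged into one kernel-verified Lean document; each statement's English description precedes it below -/
import Mathlib

section
/- Let p be an odd prime, n ≥ 1, let x ∈ (ℤ/p^nℤ)^× and u ∈ (ℤ/p^nℤ)^× satisfy u² = x, let κ ≥ 1 be an integer and t ∈ ℤ/p^nℤ. Then there is a unique v ∈ (ℤ/p^nℤ)^× with v² = x + p^κ·t and v ≡ u (mod p), and for every m ∈ ℤ this v satisfies v^m ≡ u^m + (m·2̄)·u^{m−2}·p^κ·t + (m(m−2)·8̄)·u^{m−4}·p^{2κ}·t² (mod p^{min(3κ,n)}), where 2̄ and 8̄ denote the inverses of 2 and 8 in ℤ/p^nℤ and negative powers of the unit u are powers of its inverse. -/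
theorem Units.cube_sub_dvd_zpow_sub {R : Type*} [CommRing R] (u v : Rˣ) (c : R) (hc : 2 * c = 1)
    (m : ℤ) :
    ((v : R) - u) ^ 3 ∣ ((v ^ m : Rˣ) : R) -
      (((u ^ m : Rˣ) : R) + m * ((u ^ (m - 1) : Rˣ) : R) * (v - u) +
        m * (m - 1) * c * ((u ^ (m - 2) : Rˣ) : R) * (v - u) ^ 2) := by
  set P : ℤ → R := fun m ↦ ((u ^ m : Rˣ) : R) + m * ((u ^ (m - 1) : Rˣ) : R) * (v - u) +
    m * (m - 1) * c * ((u ^ (m - 2) : Rˣ) : R) * (v - u) ^ 2 with hP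
  have step (m : ℤ) : ((v : R) - u) ^ 3 ∣ ((v ^ (m + 1) : Rˣ) : R) - P (m + 1) ↔
      ((v : R) - u) ^ 3 ∣ ((v ^ m : Rˣ) : R) - P m := by
    have h0 : ((u ^ m : Rˣ) : R) = ((u ^ (m - 2) : Rˣ) : R) * u ^ 2 := by
      rw [← Units.val_pow_eq_pow_val, ← Units.val_mul, ← zpow_natCast, ← zpow_add]
      congr 2; push_cast; ring
    have h1 : ((u ^ (m - 1) : Rˣ) : R) = ((u ^ (m - 2) : Rˣ) : R) * u := by
      rw [← Units.val_mul, ← zpow_add_one]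
      congr 2; ring
    have h2 : ((u ^ (m + 1) : Rˣ) : R) = ((u ^ (m - 2) : Rˣ) : R) * u ^ 3 := by
      rw [← Units.val_pow_eq_pow_val, ← Units.val_mul, ← zpow_natCast, ← zpow_add]
      congr 2; push_cast; ring
    have key : ((v ^ (m + 1) : Rˣ) : R) - P (m + 1) = v * (((v ^ m : Rˣ) : R) - P m) +
        ((v : R) - u) ^ 3 * (m * (m - 1) * c * ((u ^ (m - 2) : Rˣ) : R)) := by
      simp only [hP, zpow_add_one v, Units.val_mul, add_sub_cancel_right,
        show m + 1 - 2 = m - 1 by ring, h0, h1, h2]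
      push_cast
      linear_combination (-(m : R) * ((u ^ (m - 2) : Rˣ) : R) * u * (v - u) ^ 2) * hc
    rw [key, dvd_add_left (Dvd.intro _ rfl), Units.dvd_mul_left]
  induction m using Int.induction_on with
  | zero => simp
  | succ k ih => exact (step k).2 ih
  | pred k ih => exact (step (-k - 1)).1 (by rwa [sub_add_cancel])

theorem Units.cube_sub_dvd_zpow_sub_of_sq_eq {R : Type*} [CommRing R] (u v : Rˣ) (a c : R)
    (hc : 2 * c = 1) (hv : (v : R) ^ 2 = u ^ 2 + a) (m : ℤ) :
    ((v : R) - u) ^ 3 ∣ ((v ^ m : Rˣ) : R) -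
      (((u ^ m : Rˣ) : R) + m * c * ((u ^ (m - 2) : Rˣ) : R) * a +
        m * (m - 2) * c ^ 3 * ((u ^ (m - 4) : Rˣ) : R) * a ^ 2) := by
  have h1 : ((u ^ (m - 1) : Rˣ) : R) = ((u ^ (m - 4) : Rˣ) : R) * u ^ 3 := by
    rw [← Units.val_pow_eq_pow_val, ← Units.val_mul, ← zpow_natCast, ← zpow_add]
    congr 2; push_cast; ring
  have h2 : ((u ^ (m - 2) : Rˣ) : R) = ((u ^ (m - 4) : Rˣ) : R) * u ^ 2 := by
    rw [← Units.val_pow_eq_pow_val, ← Units.val_mul, ← zpow_natCast, ← zpow_add]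
    congr 2; push_cast; ring
  obtain ⟨d, hd⟩ : ∃ d : R, (v : R) = u + d := ⟨v - u, by ring⟩
  have ha : a = 2 * u * d + d ^ 2 := by rw [hd] at hv; linear_combination -hv
  have key := Units.cube_sub_dvd_zpow_sub u v c hc m
  rw [h1, h2, hd, add_sub_cancel_left] at key
  rw [h2, ha, hd, add_sub_cancel_left]
  obtain ⟨q, hq⟩ := key
  set W : R := ((u ^ (m - 4) : Rˣ) : R)
  refine ⟨q - m * (m - 2) * c ^ 3 * W * (4 * u + d), ?_⟩
  linear_combination hq +
    (-(m : R) * W * u ^ 3 * d - m * (m - 2) * c * W * u ^ 2 * d ^ 2 * (2 * c + 1)) * hc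

theorem exists_sq_eq_add_of_isNilpotent {R : Type*} [CommRing R] [Finite R] (h2 : IsUnit (2 : R))
    {π : R} (hπ : IsNilpotent π) (u : Rˣ) {a : R} (ha : π ∣ a) :
    ∃ v : Rˣ, (v : R) ^ 2 = u ^ 2 + a ∧ π ∣ v - u := by
  have nil {d : R} (hd : π ∣ d) : IsNilpotent d := by
    obtain ⟨e, rfl⟩ := hd
    exact (Commute.all _ _).isNilpotent_mul_right hπ
  let f : {d : R // π ∣ d} → {d : R // π ∣ d} := fun d ↦
    ⟨2 * u * d + d ^ 2, dvd_add (d.2.mul_left _) (dvd_pow d.2 two_ne_zero)⟩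
  have hf : Function.Injective f := by
    rintro ⟨d, hd⟩ ⟨e, he⟩ h
    have h : 2 * u * d + d ^ 2 = 2 * u * e + e ^ 2 := congrArg Subtype.val h
    have hu : IsUnit (2 * u + (d + e)) :=
      (nil (dvd_add hd he)).isUnit_add_left_of_commute (h2.mul u.isUnit) (Commute.all _ _)
    have : (d - e) * (2 * u + (d + e)) = 0 := by linear_combination h
    exact Subtype.ext (sub_eq_zero.1 (hu.mul_left_eq_zero.1 this))
  obtain ⟨⟨d, hd⟩, h⟩ := Finite.surjective_of_injective hf ⟨a, ha⟩
  have h : 2 * u * d + d ^ 2 = a := congrArg Subtype.val h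
  obtain ⟨v, hv⟩ := (nil hd).isUnit_add_left_of_commute u.isUnit (Commute.all _ _)
  exact ⟨v, by rw [hv, ← h]; ring, by rwa [hv, add_sub_cancel_left]⟩

theorem stmt_3 (p : ℕ) (hp : p.Prime) (hodd : p ≠ 2) (n : ℕ) (hn : 1 ≤ n)
    (x u : (ZMod (p ^ n))ˣ) (hu : u ^ 2 = x) (κ : ℕ) (hκ : 1 ≤ κ) (t : ZMod (p ^ n)) :
    (∃! v : (ZMod (p ^ n))ˣ,
        (v : ZMod (p ^ n)) ^ 2 = (x : ZMod (p ^ n)) + (p : ZMod (p ^ n)) ^ κ * t ∧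
        (p : ZMod (p ^ n)) ∣ ((v : ZMod (p ^ n)) - (u : ZMod (p ^ n)))) ∧
    (∀ v : (ZMod (p ^ n))ˣ,
        ((v : ZMod (p ^ n)) ^ 2 = (x : ZMod (p ^ n)) + (p : ZMod (p ^ n)) ^ κ * t ∧
         (p : ZMod (p ^ n)) ∣ ((v : ZMod (p ^ n)) - (u : ZMod (p ^ n)))) →
        ∀ m : ℤ,
          ((p : ZMod (p ^ n)) ^ (min (3 * κ) n)) ∣
            (((v ^ m : (ZMod (p ^ n))ˣ) : ZMod (p ^ n)) -
              (((u ^ m : (ZMod (p ^ n))ˣ) : ZMod (p ^ n)) +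
                (m : ZMod (p ^ n)) * (2 : ZMod (p ^ n))⁻¹ *
                  ((u ^ (m - 2) : (ZMod (p ^ n))ˣ) : ZMod (p ^ n)) * (p : ZMod (p ^ n)) ^ κ * t +
                ((m : ZMod (p ^ n)) * ((m : ZMod (p ^ n)) - 2)) * (8 : ZMod (p ^ n))⁻¹ *
                  ((u ^ (m - 4) : (ZMod (p ^ n))ˣ) : ZMod (p ^ n)) *
                    (p : ZMod (p ^ n)) ^ (2 * κ) * t ^ 2))) := by
  have : NeZero (p ^ n) := ⟨pow_ne_zero _ hp.ne_zero⟩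
  have h2 : IsUnit (2 : ZMod (p ^ n)) := by
    have := (ZMod.isUnit_iff_coprime 2 (p ^ n)).2
      (((Nat.coprime_primes Nat.prime_two hp).2 hodd.symm).pow_right n)
    exact_mod_cast this
  have hc : (2 : ZMod (p ^ n)) * 2⁻¹ = 1 := ZMod.mul_inv_of_unit _ h2
  have h8 : (8 : ZMod (p ^ n))⁻¹ = 2⁻¹ ^ 3 := by
    have h : (8 : ZMod (p ^ n)) = 2 ^ 3 := by norm_num
    have h' : (8 : ZMod (p ^ n)) * 8⁻¹ = 1 := ZMod.mul_inv_of_unit _ (h ▸ h2.pow 3)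
    refine (h ▸ h2.pow 3 : IsUnit (8 : ZMod (p ^ n))).mul_left_cancel ?_
    rw [h', h, ← mul_pow, hc, one_pow]
  have hpn : IsNilpotent (p : ZMod (p ^ n)) := ⟨n, by exact_mod_cast ZMod.natCast_self (p ^ n)⟩
  have unit_add {v w : (ZMod (p ^ n))ˣ} (h : (p : ZMod (p ^ n)) ∣ v - w) :
      IsUnit ((v : ZMod (p ^ n)) + w) := by
    obtain ⟨e, he⟩ := h
    have h : IsNilpotent ((v : ZMod (p ^ n)) - w) :=
      he ▸ (Commute.all _ _).isNilpotent_mul_right hpn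
    convert h.isUnit_add_left_of_commute (h2.mul w.isUnit) (Commute.all _ _) using 1
    ring
  have hx : (x : ZMod (p ^ n)) = u ^ 2 := by rw [← hu, Units.val_pow_eq_pow_val]
  simp only [hx]
  refine ⟨?_, ?_⟩
  · obtain ⟨v, hv, hvu⟩ := exists_sq_eq_add_of_isNilpotent h2 hpn u
      ((dvd_pow_self (p : ZMod (p ^ n)) (Nat.one_le_iff_ne_zero.1 hκ)).mul_right t)
    refine ⟨v, ⟨hv, hvu⟩, fun w ⟨hw, hwu⟩ ↦ Units.ext (sub_eq_zero.1 ?_)⟩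
    have hwv : (p : ZMod (p ^ n)) ∣ w - v := by simpa using dvd_sub hwu hvu
    refine (unit_add hwv).mul_left_eq_zero.1 ?_
    linear_combination hw - hv
  · rintro v ⟨hv, hvu⟩ m
    have hd : (p : ZMod (p ^ n)) ^ κ ∣ v - u := by
      refine (unit_add hvu).dvd_mul_right.1 ⟨t, ?_⟩
      linear_combination hv
    refine (pow_dvd_pow _ (min_le_left _ _)).trans ?_
    rw [mul_comm 3 κ, pow_mul]
    refine (pow_dvd_pow_of_dvd hd 3).trans ?_
    convert Units.cube_sub_dvd_zpow_sub_of_sq_eq u v _ _ hc hv m using 2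
    rw [h8]
    ring
end

section
/- Let p be an odd prime, n ≥ κ0 ≥ 1, let X ⊆ ℤ/p^nℤ be invariant under translations by p^{κ0}ℤ/p^nℤ, and let f, f1 : X → ℤ/p^nℤ satisfy f(x + p^κ·t) ≡ f(x) + f1(x)·p^κ·t (mod p^{min(2κ,n)}) for all x ∈ X, t ∈ ℤ/p^nℤ and integers κ ≥ κ0. Suppose a ∈ X and integers j, ρ with 0 ≤ ρ < n satisfy f(a) ≡ 0 (mod p^j), p^ρ exactly divides f1(a), j ≥ 2ρ+1, j ≥ ρ+κ0, and j ≤ n−1. Then there is exactly one residue class t modulo p^{n−j} such that f(a + t·p^{j−ρ}) = 0 in ℤ/p^nℤ. -/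
theorem ZMod.prime_pow_dvd_intCast_iff (p : ℕ) {n r : ℕ} (hr : r ≤ n) (z : ℤ) :
    (p : ZMod (p ^ n)) ^ r ∣ (z : ZMod (p ^ n)) ↔ (p : ℤ) ^ r ∣ z := by
  constructor
  · rintro ⟨c, hc⟩
    obtain ⟨c, rfl⟩ := ZMod.intCast_surjective c
    have h : ((z - (p : ℤ) ^ r * c : ℤ) : ZMod (p ^ n)) = 0 := by
      push_cast
      rw [hc, sub_self]
    rw [ZMod.intCast_zmod_eq_zero_iff_dvd] at h
    push_cast at h
    exact (dvd_sub_left (dvd_mul_right _ _)).1 ((pow_dvd_pow _ hr).trans h)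
  · rintro ⟨c, rfl⟩
    push_cast
    exact dvd_mul_right _ _

/-- Cancelling `p ^ k` and a factor prime to `p` from a divisibility in `ZMod (p ^ n)`. -/
theorem ZMod.prime_pow_dvd_of_dvd_mul {p : ℕ} (hp : p.Prime) {n k r : ℕ} (hr : k + r ≤ n)
    {y : ZMod (p ^ n)} {u : ℤ} (hu : ¬ (p : ℤ) ∣ u)
    (h : (p : ZMod (p ^ n)) ^ (k + r) ∣ y * (p : ZMod (p ^ n)) ^ k * (u : ZMod (p ^ n))) :
    (p : ZMod (p ^ n)) ^ r ∣ y := by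
  obtain ⟨y, rfl⟩ := ZMod.intCast_surjective y
  have h' : (p : ZMod (p ^ n)) ^ (k + r) ∣ ((y * (p : ℤ) ^ k * u : ℤ) : ZMod (p ^ n)) := by
    push_cast
    exact h
  rw [ZMod.prime_pow_dvd_intCast_iff p hr] at h'
  rw [ZMod.prime_pow_dvd_intCast_iff p (by lia)]
  have hpp : Prime (p : ℤ) := Nat.prime_iff_prime_int.1 hp
  have hk : (p : ℤ) ^ k ≠ 0 := pow_ne_zero _ hpp.ne_zero
  rw [pow_add, show y * (p : ℤ) ^ k * u = (p : ℤ) ^ k * (y * u) by ring,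
    mul_dvd_mul_iff_left hk] at h'
  exact hpp.pow_dvd_of_dvd_mul_right r hu h'

theorem ZMod.prime_pow_mul_eq_of_cast_eq {p : ℕ} {n j : ℕ} (hj : j ≤ n) {c d : ℤ}
    (h : (c : ZMod (p ^ (n - j))) = d) :
    (p : ZMod (p ^ n)) ^ j * c = (p : ZMod (p ^ n)) ^ j * d := by
  rw [ZMod.intCast_eq_intCast_iff_dvd_sub] at h
  have h2 : ((p ^ n : ℕ) : ℤ) ∣ (p : ℤ) ^ j * d - (p : ℤ) ^ j * c := by
    rw [← mul_sub, ← pow_mul_pow_sub p hj]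
    push_cast at h ⊢
    exact mul_dvd_mul_left _ h
  rw [← ZMod.intCast_eq_intCast_iff_dvd_sub] at h2
  exact_mod_cast h2

theorem stmt_7 (p : ℕ) (hp : p.Prime) (hodd : p ≠ 2) (n κ0 : ℕ)
    (hκ0 : 1 ≤ κ0) (hκ0n : κ0 ≤ n)
    (X : Set (ZMod (p ^ n)))
    (hX : ∀ x ∈ X, ∀ t : ZMod (p ^ n), x + (p : ZMod (p ^ n)) ^ κ0 * t ∈ X)
    (f f1 : ZMod (p ^ n) → ZMod (p ^ n))
    (hdiff : ∀ x ∈ X, ∀ t : ZMod (p ^ n), ∀ κ : ℕ, κ0 ≤ κ →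
      ((p : ZMod (p ^ n)) ^ (min (2 * κ) n)) ∣
        (f (x + (p : ZMod (p ^ n)) ^ κ * t) - f x - f1 x * (p : ZMod (p ^ n)) ^ κ * t))
    (a : ZMod (p ^ n)) (ha : a ∈ X) (j ρ : ℕ) (hρ : ρ < n)
    (hfa : ((p : ZMod (p ^ n)) ^ j) ∣ f a)
    (hf1a : ((p : ZMod (p ^ n)) ^ ρ) ∣ f1 a ∧ ¬ ((p : ZMod (p ^ n)) ^ (ρ + 1)) ∣ f1 a)
    (hj1 : 2 * ρ + 1 ≤ j) (hj2 : ρ + κ0 ≤ j) (hj3 : j ≤ n - 1) :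
    ∃! t : ZMod (p ^ (n - j)),
      f (a + ((t.val : ℕ) : ZMod (p ^ n)) * (p : ZMod (p ^ n)) ^ (j - ρ)) = 0 := by
  obtain ⟨k, rfl⟩ : ∃ k, j = ρ + k := ⟨j - ρ, by lia⟩
  rw [Nat.add_sub_cancel_left]
  have : NeZero (p ^ (n - (ρ + k))) := ⟨pow_ne_zero _ hp.ne_zero⟩
  have hpp : Prime (p : ℤ) := Nat.prime_iff_prime_int.1 hp
  have hmem (t : ZMod (p ^ n)) : a + t * (p : ZMod (p ^ n)) ^ k ∈ X := by
    convert hX a ha ((p : ZMod (p ^ n)) ^ (k - κ0) * t) using 2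
    rw [← mul_assoc, ← pow_add, Nat.add_sub_cancel' (by lia), mul_comm]
  have hderiv (s : ZMod (p ^ n)) :
      ¬ (p : ZMod (p ^ n)) ^ (ρ + 1) ∣ f1 (a + s * (p : ZMod (p ^ n)) ^ k) := by
    intro h
    apply hf1a.2
    rw [← dvd_sub_right h]
    refine ZMod.prime_pow_dvd_of_dvd_mul hp (k := k) (u := 1) (by lia)
      (fun h => hpp.not_isUnit (isUnit_of_dvd_one h)) ?_
    refine (pow_dvd_pow _ (show k + (ρ + 1) ≤ min (2 * k) n by lia)).trans ?_
    have h1 := hdiff _ (hmem s) 1 k (by lia)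
    have h2 := hdiff a ha s k (by lia)
    have h3 := hdiff a ha (s + 1) k (by lia)
    convert h3.sub (h1.add h2) using 1
    rw [show a + s * (p : ZMod (p ^ n)) ^ k + (p : ZMod (p ^ n)) ^ k * 1 =
      a + (p : ZMod (p ^ n)) ^ k * (s + 1) by ring, mul_comm s]
    push_cast
    ring
  have hval (s : ZMod (p ^ n)) : ∃ c : ℤ,
      f (a + s * (p : ZMod (p ^ n)) ^ k) = (p : ZMod (p ^ n)) ^ (ρ + k) * c := by
    have h1 := (pow_dvd_pow _ (show ρ + k ≤ min (2 * k) n by lia)).trans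
      (hdiff a ha s k (by lia))
    have h2 : (p : ZMod (p ^ n)) ^ (ρ + k) ∣ f1 a * (p : ZMod (p ^ n)) ^ k * s := by
      rw [pow_add]
      exact (mul_dvd_mul_right hf1a.1 _).mul_right _
    obtain ⟨c, hc⟩ := (h1.add h2).add hfa
    obtain ⟨c, rfl⟩ := ZMod.intCast_surjective c
    refine ⟨c, ?_⟩
    rw [← hc, mul_comm s]
    ring
  have hinj (s t : ZMod (p ^ (n - (ρ + k))))
      (h : f (a + ((s.val : ℕ) : ZMod (p ^ n)) * (p : ZMod (p ^ n)) ^ k) =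
        f (a + ((t.val : ℕ) : ZMod (p ^ n)) * (p : ZMod (p ^ n)) ^ k)) : s = t := by
    by_contra hst
    have hnd : ¬ (p : ℤ) ^ (n - (ρ + k)) ∣ (s.val : ℤ) - t.val := by
      intro hd
      apply hst
      have := (ZMod.intCast_eq_intCast_iff_dvd_sub (t.val : ℤ) s.val (p ^ (n - (ρ + k)))).2
        (by exact_mod_cast hd)
      simpa using this.symm
    have hne : (s.val : ℤ) - t.val ≠ 0 := fun h0 => hnd (h0 ▸ dvd_zero _)
    have hfin : FiniteMultiplicity (p : ℤ) ((s.val : ℤ) - t.val) :=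
      Int.finiteMultiplicity_iff.2 ⟨by simpa using hp.ne_one, hne⟩
    obtain ⟨u, hd, hu⟩ := hfin.exists_eq_pow_mul_and_not_dvd
    set m := multiplicity (p : ℤ) ((s.val : ℤ) - t.val)
    have hm : m < n - (ρ + k) := by
      by_contra! hm
      exact hnd (hd ▸ (pow_dvd_pow _ hm).mul_right _)
    have hcast : ((s.val : ℕ) : ZMod (p ^ n)) =
        ((t.val : ℕ) : ZMod (p ^ n)) + (p : ZMod (p ^ n)) ^ m * (u : ZMod (p ^ n)) := by
      have := congrArg (Int.cast : ℤ → ZMod (p ^ n)) hd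
      push_cast at this
      rw [← this]
      ring
    apply hderiv ((t.val : ℕ) : ZMod (p ^ n))
    refine ZMod.prime_pow_dvd_of_dvd_mul hp (k := k + m) (by lia) hu ?_
    refine (pow_dvd_pow _ (show k + m + (ρ + 1) ≤ min (2 * (k + m)) n by lia)).trans ?_
    have h1 := hdiff _ (hmem ((t.val : ℕ) : ZMod (p ^ n))) (u : ZMod (p ^ n)) (k + m) (by lia)
    rw [show a + ((t.val : ℕ) : ZMod (p ^ n)) * (p : ZMod (p ^ n)) ^ k +
        (p : ZMod (p ^ n)) ^ (k + m) * (u : ZMod (p ^ n)) =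
        a + ((s.val : ℕ) : ZMod (p ^ n)) * (p : ZMod (p ^ n)) ^ k by rw [hcast]; ring,
      h, sub_self, zero_sub, dvd_neg] at h1
    exact h1
  choose c hc using fun t : ZMod (p ^ (n - (ρ + k))) => hval ((t.val : ℕ) : ZMod (p ^ n))
  have hcinj : Function.Injective fun t => (c t : ZMod (p ^ (n - (ρ + k)))) := fun s t hst =>
    hinj s t (by rw [hc, hc, ZMod.prime_pow_mul_eq_of_cast_eq (by lia) hst])
  obtain ⟨t, ht⟩ := Finite.surjective_of_injective hcinj 0
  have ht0 : f (a + ((t.val : ℕ) : ZMod (p ^ n)) * (p : ZMod (p ^ n)) ^ k) = 0 := by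
    rw [hc, ZMod.prime_pow_mul_eq_of_cast_eq (d := 0) (by lia) (by simpa using ht)]
    simp
  exact ⟨t, ht0, fun s hs => hinj s t (hs.trans ht0.symm)⟩
end
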